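/- Let p be an odd prime, f : ℤ_p → ℤ_p continuous, and λ ∈ ℚ_p with ‖λ‖_p > 1. Then all fermionic integrals appearing below exist, the series converges, and the Stirling series holds: −∫_{ℤ_p} (λ+f(a))·log_p(λ+f(a)) dμ_{−1}(a) = −E_1^f(0) − Σ_{n=1}^∞ ((−1)^{n+1}/(n(n+1)))·E_{n+1}^f(0)·λ^{−n} − E_1^f(λ)·log_p(λ), where E_m^f(u) := ∫_{ℤ_p} (u+f(a))^m dμ_{−1}(a). -/

import Mathlib

open Filter Topology

namespace PZeta

variable (p : ℕ) [Fact p.Prime]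

/-- The `N`-th partial sum defining the fermionic integral
`∫_{ℤ_p} g dμ₋₁ = lim_N Σ_{a=0}^{p^N-1} (-1)^a g(a)`. -/
noncomputable def fermSum (g : ℤ_[p] → ℚ_[p]) (N : ℕ) : ℚ_[p] :=
  ∑ a ∈ Finset.range (p ^ N), (-1 : ℚ_[p]) ^ a * g (a : ℤ_[p])

/-- The `N`-th partial sum defining the Volkenborn integral
`∫_{ℤ_p} g da = lim_N p^{-N} Σ_{a=0}^{p^N-1} g(a)`. -/
noncomputable def volkSum (g : ℤ_[p] → ℚ_[p]) (N : ℕ) : ℚ_[p] :=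
  ((p : ℚ_[p]) ^ N)⁻¹ * ∑ a ∈ Finset.range (p ^ N), g (a : ℤ_[p])

/-- The unit part `x·p^{-v_p(x)}` of a nonzero `p`-adic number. -/
noncomputable def unitPart (x : ℚ_[p]) : ℚ_[p] := x * (p : ℚ_[p]) ^ (-x.valuation)

/-- The Teichmüller representative of a `p`-adic unit, `lim_n x^{p^n}`. -/
noncomputable def teich (x : ℚ_[p]) : ℚ_[p] :=
  limUnder atTop fun n : ℕ => x ^ p ^ n

/-- The projection `⟨x⟩ ∈ 1 + pℤ_p`, via `x = p^{v_p(x)}·ζ·⟨x⟩`. -/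
noncomputable def angle (x : ℚ_[p]) : ℚ_[p] := unitPart p x / teich p (unitPart p x)

/-- `ω_v(x) := x / ⟨x⟩ = p^{v_p(x)}·ζ`. -/
noncomputable def omegaV (x : ℚ_[p]) : ℚ_[p] := x / angle p x

/-- The generalized binomial coefficient `C(t,n) = t(t-1)⋯(t-n+1)/n!`. -/
noncomputable def gbinom (t : ℚ_[p]) (n : ℕ) : ℚ_[p] :=
  (∏ i ∈ Finset.range n, (t - (i : ℚ_[p]))) / (n.factorial : ℚ_[p])

/-- The power `y^t` defined by the binomial series `Σ_n C(t,n)(y-1)^n`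
(used for `y ∈ 1 + pℤ_p` and `t ∈ ℤ_p`). -/
noncomputable def bpow (y t : ℚ_[p]) : ℚ_[p] := ∑' n : ℕ, gbinom p t n * (y - 1) ^ n

/-- The Iwasawa `p`-adic logarithm: `log_p x = Σ_{n≥1} (-1)^{n+1}(⟨x⟩-1)^n/n`
(one has `log_p p = 0` and `log_p ζ = 0` for roots of unity of order prime to `p`). -/
noncomputable def padicLog (x : ℚ_[p]) : ℚ_[p] :=
  ∑' n : ℕ, (-1 : ℚ_[p]) ^ n * (angle p x - 1) ^ (n + 1) / ((n : ℚ_[p]) + 1)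

/-- The power `y^t` defined by the exponential series `Σ_n (t·log_p y)^n/n!`
(used for `y ∈ 1 + pℤ_p` and `‖t‖ < p^{(p-2)/(p-1)}`). -/
noncomputable def epow (y t : ℚ_[p]) : ℚ_[p] :=
  ∑' n : ℕ, (t * padicLog p y) ^ n / (n.factorial : ℚ_[p])

/-- `f : ℤ_p → ℤ_p` is everywhere analytic with integral coefficients:
`f(x) = Σ_k c_k x^k` with `‖c_k‖ ≤ 1`, `c_k → 0`. -/
def EverywhereAnalytic (f : ℤ_[p] → ℤ_[p]) : Prop :=
  ∃ c : ℕ → ℚ_[p], (∀ k, ‖c k‖ ≤ 1) ∧ Tendsto c atTop (𝓝 0) ∧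
    ∀ x : ℤ_[p], (f x : ℚ_[p]) = ∑' k : ℕ, c k * (x : ℚ_[p]) ^ k

/-- The `p`-adic Hurwitz-type Euler zeta function w.r.t. `f`:
`ζ_{p,E}^f(s,λ) = ∫_{ℤ_p} ⟨λ+f(a)⟩^{1-s} dμ₋₁(a)`. -/
noncomputable def zetaE (f : ℤ_[p] → ℤ_[p]) (s : ℤ_[p]) (lam : ℚ_[p]) : ℚ_[p] :=
  limUnder atTop
    (fermSum p fun a => bpow p (angle p (lam + (f a : ℚ_[p]))) (1 - (s : ℚ_[p])))

/-- The `p`-adic Hurwitz zeta function w.r.t. `f`: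
`ζ_p^f(s,λ) = (s-1)⁻¹ ∫_{ℤ_p} ⟨λ+f(a)⟩^{1-s} da`. -/
noncomputable def zetaH (f : ℤ_[p] → ℤ_[p]) (s : ℤ_[p]) (lam : ℚ_[p]) : ℚ_[p] :=
  ((s : ℚ_[p]) - 1)⁻¹ *
    limUnder atTop
      (volkSum p fun a => bpow p (angle p (lam + (f a : ℚ_[p]))) (1 - (s : ℚ_[p])))

end PZeta

open PZeta

namespace PZeta

section Fermionic

variable {p : ℕ} [Fact p.Prime]

theorem norm_inv_natCast_le (k : ℕ) : ‖((k : ℚ_[p]))⁻¹‖ ≤ k := by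
  rcases eq_or_ne k 0 with rfl | hk
  · simp
  have hp : (0 : ℝ) < p := by exact_mod_cast (Fact.out : p.Prime).pos
  rw [norm_inv, Padic.norm_eq_zpow_neg_valuation (by exact_mod_cast hk), Padic.valuation_natCast,
    zpow_neg, inv_inv, zpow_natCast]
  exact_mod_cast Nat.le_of_dvd (Nat.pos_of_ne_zero hk) pow_padicValNat_dvd

theorem norm_fermSum_le {g : ℤ_[p] → ℚ_[p]} {C : ℝ} (hC : 0 ≤ C) (hg : ∀ x, ‖g x‖ ≤ C) (N : ℕ) :
    ‖fermSum p g N‖ ≤ C := by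
  refine IsUltrametricDist.norm_sum_le_of_forall_le_of_nonneg hC fun a _ => ?_
  simpa using hg a

theorem sum_range_mul_eq {M : Type*} [AddCommMonoid M] (F : ℕ → M) (n m : ℕ) :
    ∑ a ∈ Finset.range (n * m), F a =
      ∑ c ∈ Finset.range m, ∑ b ∈ Finset.range n, F (n * c + b) := by
  induction m with
  | zero => simp
  | succ m ih => rw [Nat.mul_succ, Finset.sum_range_add, ih, Finset.sum_range_succ]

theorem sum_range_neg_one_pow_of_odd {R : Type*} [Ring R] {m : ℕ} (hm : Odd m) :
    ∑ c ∈ Finset.range m, (-1 : R) ^ c = 1 := by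
  obtain ⟨k, rfl⟩ := hm
  induction k with
  | zero => simp
  | succ k ih =>
    rw [show 2 * (k + 1) + 1 = 2 * k + 1 + 1 + 1 by ring, Finset.sum_range_succ,
      Finset.sum_range_succ, ih]
    simp [pow_succ, pow_mul]

theorem fermSum_succ_sub (hp : Odd p) (g : ℤ_[p] → ℚ_[p]) (N : ℕ) :
    fermSum p g (N + 1) - fermSum p g N =
      ∑ c ∈ Finset.range p, ∑ b ∈ Finset.range (p ^ N),
        (-1 : ℚ_[p]) ^ c * (-1) ^ b * (g ((p ^ N * c + b : ℕ) : ℤ_[p]) - g (b : ℤ_[p])) := by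
  have h : fermSum p g N = ∑ c ∈ Finset.range p, ∑ b ∈ Finset.range (p ^ N),
      (-1 : ℚ_[p]) ^ c * ((-1) ^ b * g (b : ℤ_[p])) := by
    simp_rw [← Finset.mul_sum]
    rw [← Finset.sum_mul, sum_range_neg_one_pow_of_odd hp, one_mul, fermSum]
  rw [h, fermSum, pow_succ, sum_range_mul_eq, ← Finset.sum_sub_distrib]
  refine Finset.sum_congr rfl fun c _ => ?_
  rw [← Finset.sum_sub_distrib]
  refine Finset.sum_congr rfl fun b _ => ?_
  rw [pow_add, pow_mul, (hp.pow : Odd (p ^ N)).neg_one_pow]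
  ring

/-- The fermionic integral of a continuous function exists. -/
theorem exists_tendsto_fermSum (hp : Odd p) {g : ℤ_[p] → ℚ_[p]} (hg : Continuous g) :
    ∃ I, Tendsto (fermSum p g) atTop (𝓝 I) := by
  refine cauchySeq_tendsto_of_complete
    (NonarchimedeanAddGroup.cauchySeq_of_tendsto_sub_nhds_zero ?_)
  rw [Metric.tendsto_atTop]
  intro ε hε
  obtain ⟨δ, hδ, hgδ⟩ := Metric.uniformContinuous_iff.1
    (CompactSpace.uniformContinuous_of_continuous hg) (ε / 2) (by positivity)
  have hp1 : ‖(p : ℤ_[p])‖ < 1 := by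
    rw [PadicInt.norm_p]
    exact inv_lt_one_of_one_lt₀ (by exact_mod_cast (Fact.out : p.Prime).one_lt)
  obtain ⟨N₀, hN₀⟩ := exists_pow_lt_of_lt_one hδ hp1
  refine ⟨N₀, fun N hN => ?_⟩
  rw [dist_zero_right, fermSum_succ_sub hp]
  refine lt_of_le_of_lt ?_ (half_lt_self hε)
  refine IsUltrametricDist.norm_sum_le_of_forall_le_of_nonneg (by positivity) fun c _ => ?_
  refine IsUltrametricDist.norm_sum_le_of_forall_le_of_nonneg (by positivity) fun b _ => ?_
  have hd : dist ((p ^ N * c + b : ℕ) : ℤ_[p]) (b : ℤ_[p]) < δ := by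
    rw [dist_eq_norm]
    push_cast
    rw [add_sub_cancel_right, norm_mul, norm_pow]
    calc ‖(p : ℤ_[p])‖ ^ N * ‖(c : ℤ_[p])‖ ≤ ‖(p : ℤ_[p])‖ ^ N₀ * 1 :=
          mul_le_mul (pow_le_pow_of_le_one (norm_nonneg _) hp1.le hN) (PadicInt.norm_le_one _)
            (norm_nonneg _) (by positivity)
      _ < δ := by rwa [mul_one]
  have := (hgδ hd).le
  rw [dist_eq_norm] at this
  simpa using this

end Fermionic

section Logarithm

variable {p : ℕ} [Fact p.Prime]

variable (p) in
/-- The power series `log (1 + u) = Σ_n (-1)^n u^(n+1) / (n+1)`. -/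
noncomputable def logSeries (u : ℚ_[p]) : ℚ_[p] :=
  ∑' n : ℕ, (-1 : ℚ_[p]) ^ n * u ^ (n + 1) / ((n : ℚ_[p]) + 1)

theorem padicLog_eq_logSeries (x : ℚ_[p]) : padicLog p x = logSeries p (angle p x - 1) := rfl

theorem norm_inv_natCast_add_one_le (k : ℕ) : ‖((k : ℚ_[p]) + 1)⁻¹‖ ≤ k + 1 := by
  exact_mod_cast norm_inv_natCast_le (p := p) (k + 1)

theorem summable_add_one_mul_pow_succ {r : ℝ} (h0 : 0 ≤ r) (h1 : r < 1) :
    Summable fun n : ℕ => ((n : ℝ) + 1) * r ^ (n + 1) := by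
  have h := summable_pow_mul_geometric_of_norm_lt_one 1 (r := r)
    (by rwa [Real.norm_of_nonneg h0])
  have := (summable_nat_add_iff 1).2 h
  simpa using this

theorem summable_logSeries {u : ℚ_[p]} (hu : ‖u‖ < 1) :
    Summable fun n : ℕ => (-1 : ℚ_[p]) ^ n * u ^ (n + 1) / ((n : ℚ_[p]) + 1) := by
  refine Summable.of_norm_bounded (summable_add_one_mul_pow_succ (norm_nonneg u) hu) fun n => ?_
  rw [div_eq_mul_inv, norm_mul, norm_mul, norm_pow, norm_neg, norm_one, one_pow, one_mul, norm_pow,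
    mul_comm]
  exact mul_le_mul_of_nonneg_right (norm_inv_natCast_add_one_le n) (by positivity)

theorem tendsto_natCast_prime_pow : Tendsto (fun N : ℕ => (p : ℚ_[p]) ^ N) atTop (𝓝 0) :=
  tendsto_pow_atTop_nhds_zero_of_norm_lt_one Padic.norm_p_lt_one

theorem tendsto_choose_prime_pow_sub_one (k : ℕ) :
    Tendsto (fun N : ℕ => ((p ^ N - 1).choose k : ℚ_[p])) atTop (𝓝 ((-1) ^ k)) := by
  have hpos (N : ℕ) : p ^ N - 1 + 1 = p ^ N :=
    Nat.sub_add_cancel (Nat.pow_pos (Fact.out : p.Prime).pos)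
  induction k with
  | zero => simp
  | succ k ih =>
    have hk : ((k : ℚ_[p]) + 1) ≠ 0 := by exact_mod_cast k.succ_ne_zero
    have key (N : ℕ) : ((p ^ N - 1).choose (k + 1) : ℚ_[p]) =
        (p : ℚ_[p]) ^ N * ((p ^ N - 1).choose k) / (k + 1) - (p ^ N - 1).choose k := by
      have h1 := Nat.add_one_mul_choose_eq (p ^ N - 1) k
      have h2 := Nat.choose_succ_succ' (p ^ N - 1) k
      rw [h2, hpos] at h1
      have h3 : (p : ℚ_[p]) ^ N * ((p ^ N - 1).choose k) =
          ((p ^ N - 1).choose k + (p ^ N - 1).choose (k + 1)) * (k + 1) := by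
        exact_mod_cast h1
      rw [h3]
      field_simp
      ring
    simp_rw [key]
    have := ((tendsto_natCast_prime_pow.mul ih).div_const ((k : ℚ_[p]) + 1)).sub ih
    simpa [pow_succ] using this

theorem one_add_pow_sub_one_div {m : ℕ} (hm : m ≠ 0) (u : ℚ_[p]) :
    ((1 + u) ^ m - 1) / m =
      ∑' k : ℕ, ((m - 1).choose k : ℚ_[p]) * u ^ (k + 1) / ((k : ℚ_[p]) + 1) := by
  have hm' : (m : ℚ_[p]) ≠ 0 := by exact_mod_cast hm
  rw [tsum_eq_sum (s := Finset.range m)]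
  · rw [add_comm, add_pow, Finset.sum_range_succ']
    simp only [one_pow, mul_one, pow_zero, Nat.choose_zero_right, Nat.cast_one,
      add_sub_cancel_right]
    rw [Finset.sum_div]
    refine Finset.sum_congr rfl fun k _ => ?_
    have hk : ((k : ℚ_[p]) + 1) ≠ 0 := by exact_mod_cast k.succ_ne_zero
    have h1 := Nat.add_one_mul_choose_eq (m - 1) k
    rw [Nat.sub_add_cancel (Nat.pos_of_ne_zero hm)] at h1
    have h2 : (m : ℚ_[p]) * (m - 1).choose k = m.choose (k + 1) * (k + 1) := by exact_mod_cast h1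
    field_simp
    linear_combination (-u ^ (k + 1)) * h2
  · intro k hk
    rw [Nat.choose_eq_zero_of_lt (by simp at hk; omega)]
    simp

/-- `log (1 + u)` is the limit of `((1 + u)^(p^N) - 1) / p^N`. -/
theorem tendsto_logSeries {u : ℚ_[p]} (hu : ‖u‖ < 1) :
    Tendsto (fun N : ℕ => ((1 + u) ^ p ^ N - 1) / (p : ℚ_[p]) ^ N) atTop (𝓝 (logSeries p u)) := by
  have h (N : ℕ) := one_add_pow_sub_one_div (p := p)
    (pow_ne_zero N (Fact.out : p.Prime).ne_zero) u
  push_cast at h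
  simp_rw [h]
  refine tendsto_tsum_of_dominated_convergence
    (summable_add_one_mul_pow_succ (norm_nonneg u) hu) (fun k => ?_) (Eventually.of_forall ?_)
  · exact ((tendsto_choose_prime_pow_sub_one k).mul_const _).div_const _
  · intro N k
    rw [div_eq_mul_inv, norm_mul, norm_mul, norm_pow, mul_comm]
    refine mul_le_mul (norm_inv_natCast_add_one_le k) ?_ (by positivity) (by positivity)
    refine mul_le_of_le_one_left (by positivity) ?_
    exact_mod_cast Padic.norm_int_le_one (p := p) ((p ^ N - 1).choose k : ℕ)

/-- Additivity of the logarithm on principal units. -/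
theorem logSeries_add_add_mul {u v : ℚ_[p]} (hu : ‖u‖ < 1) (hv : ‖v‖ < 1) :
    logSeries p (u + v + u * v) = logSeries p u + logSeries p v := by
  have huv : ‖u + v + u * v‖ < 1 := by
    refine (Padic.nonarchimedean _ _).trans_lt (max_lt ?_ ?_)
    · exact (Padic.nonarchimedean _ _).trans_lt (max_lt hu hv)
    · rw [norm_mul]
      exact mul_lt_one_of_nonneg_of_lt_one_left (norm_nonneg _) hu hv.le
  refine tendsto_nhds_unique (tendsto_logSeries huv) ?_
  have hU := tendsto_logSeries hu
  have hV := tendsto_logSeries hv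
  have h := (tendsto_natCast_prime_pow (p := p)).mul (hU.mul hV) |>.add (hU.add hV)
  rw [zero_mul, zero_add] at h
  refine h.congr fun N => ?_
  have hp : (p : ℚ_[p]) ^ N ≠ 0 :=
    pow_ne_zero _ (by exact_mod_cast (Fact.out : p.Prime).ne_zero)
  rw [show 1 + (u + v + u * v) = (1 + u) * (1 + v) by ring, mul_pow]
  field_simp
  ring

theorem norm_pow_prime_pow_sub_le {a b : ℚ_[p]} (ha : ‖a‖ ≤ 1) (hb : ‖b‖ ≤ 1)
    (hab : ‖a - b‖ < 1) (n : ℕ) :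
    ‖a ^ p ^ n - b ^ p ^ n‖ ≤ ‖(p : ℚ_[p])‖ ^ (n + 1) := by
  obtain ⟨a, rfl⟩ : ∃ a' : ℤ_[p], (a' : ℚ_[p]) = a := ⟨⟨a, ha⟩, rfl⟩
  obtain ⟨b, rfl⟩ : ∃ b' : ℤ_[p], (b' : ℚ_[p]) = b := ⟨⟨b, hb⟩, rfl⟩
  have h1 : (p : ℤ_[p]) ∣ a - b := by
    rw [← PadicInt.norm_lt_one_iff_dvd]
    simpa [PadicInt.norm_def] using hab
  obtain ⟨c, hc⟩ := dvd_sub_pow_of_dvd_sub h1 n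
  have h2 : (a : ℚ_[p]) ^ p ^ n - (b : ℚ_[p]) ^ p ^ n = (p : ℚ_[p]) ^ (n + 1) * c := by
    exact_mod_cast congrArg (fun z : ℤ_[p] => (z : ℚ_[p])) hc
  rw [h2, norm_mul, norm_pow]
  exact mul_le_of_le_one_right (by positivity) (PadicInt.norm_le_one c)

theorem tendsto_pow_prime_pow_sub {a b : ℚ_[p]} (ha : ‖a‖ ≤ 1) (hb : ‖b‖ ≤ 1)
    (hab : ‖a - b‖ < 1) :
    Tendsto (fun n : ℕ => a ^ p ^ n - b ^ p ^ n) atTop (𝓝 0) := by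
  refine squeeze_zero_norm (norm_pow_prime_pow_sub_le ha hb hab) ?_
  exact (tendsto_pow_atTop_nhds_zero_of_lt_one (norm_nonneg _) Padic.norm_p_lt_one).comp
    (tendsto_add_atTop_nat 1)

theorem norm_pow_prime_sub_self_lt_one {w : ℚ_[p]} (hw : ‖w‖ ≤ 1) : ‖w ^ p - w‖ < 1 := by
  obtain ⟨w, rfl⟩ : ∃ w' : ℤ_[p], (w' : ℚ_[p]) = w := ⟨⟨w, hw⟩, rfl⟩
  have h : w ^ p - w ∈ RingHom.ker (PadicInt.toZMod : ℤ_[p] →+* ZMod p) := by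
    rw [RingHom.mem_ker, map_sub, map_pow, ZMod.pow_card, sub_self]
  rw [PadicInt.ker_toZMod, IsLocalRing.mem_maximalIdeal, PadicInt.mem_nonunits] at h
  exact_mod_cast h

theorem tendsto_teich {w : ℚ_[p]} (hw : ‖w‖ ≤ 1) :
    Tendsto (fun n : ℕ => w ^ p ^ n) atTop (𝓝 (teich p w)) := by
  have hc : CauchySeq fun n : ℕ => w ^ p ^ n := by
    refine NonarchimedeanAddGroup.cauchySeq_of_tendsto_sub_nhds_zero ?_
    have := tendsto_pow_prime_pow_sub (a := w ^ p) (b := w)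
      (by rw [norm_pow]; exact pow_le_one₀ (norm_nonneg _) hw) hw
      (norm_pow_prime_sub_self_lt_one hw)
    refine this.congr fun n => ?_
    rw [← pow_mul, ← pow_succ']
  exact hc.tendsto_limUnder

theorem norm_teich_sub_lt_one {w : ℚ_[p]} (hw : ‖w‖ ≤ 1) : ‖teich p w - w‖ < 1 := by
  have hb (n : ℕ) : ‖w ^ p ^ n - w‖ ≤ ‖(p : ℚ_[p])‖ := by
    induction n with
    | zero => simp
    | succ n ih =>
      have h := norm_pow_prime_pow_sub_le (a := w ^ p) (b := w)
        (by rw [norm_pow]; exact pow_le_one₀ (norm_nonneg _) hw) hw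
        (norm_pow_prime_sub_self_lt_one hw) n
      rw [← pow_mul, ← pow_succ'] at h
      rw [← sub_add_sub_cancel (w ^ p ^ (n + 1)) (w ^ p ^ n) w]
      refine (Padic.nonarchimedean _ _).trans (max_le (h.trans ?_) ih)
      exact pow_le_of_le_one (norm_nonneg _) Padic.norm_p_lt_one.le n.succ_ne_zero
  exact (le_of_tendsto' ((tendsto_teich hw).sub_const w).norm hb).trans_lt Padic.norm_p_lt_one

theorem teich_eq_of_norm_sub_lt_one {a b : ℚ_[p]} (ha : ‖a‖ ≤ 1) (hb : ‖b‖ ≤ 1)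
    (hab : ‖a - b‖ < 1) : teich p a = teich p b := by
  have h := (tendsto_pow_prime_pow_sub ha hb hab).add (tendsto_teich hb)
  simp only [sub_add_cancel, zero_add] at h
  exact tendsto_nhds_unique (tendsto_teich ha) h

theorem norm_unitPart {x : ℚ_[p]} (hx : x ≠ 0) : ‖unitPart p x‖ = 1 := by
  have hp : (p : ℝ) ≠ 0 := by exact_mod_cast (Fact.out : p.Prime).ne_zero
  rw [unitPart, norm_mul, Padic.norm_p_zpow, Padic.norm_eq_zpow_neg_valuation hx,
    ← zpow_add₀ hp]
  simp

theorem norm_one_add_eq_one {u : ℚ_[p]} (hu : ‖u‖ < 1) : ‖1 + u‖ = 1 := by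
  rw [Padic.add_eq_max_of_ne (by rw [norm_one]; exact hu.ne'), norm_one, max_eq_left hu.le]

theorem valuation_mul_one_add {x u : ℚ_[p]} (hx : x ≠ 0) (hu : ‖u‖ < 1) :
    (x * (1 + u)).valuation = x.valuation := by
  have h1 := norm_one_add_eq_one hu
  have hu0 : 1 + u ≠ 0 := by
    rw [← norm_ne_zero_iff, h1]
    exact one_ne_zero
  have hp : (1 : ℝ) < p := by exact_mod_cast (Fact.out : p.Prime).one_lt
  rw [Padic.norm_eq_zpow_neg_valuation hu0, zpow_eq_one_iff_right₀ (by linarith) hp.ne'] at h1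
  rw [Padic.valuation_mul hx hu0]
  omega

theorem teich_ne_zero {w : ℚ_[p]} (hw : ‖w‖ = 1) : teich p w ≠ 0 := by
  intro h
  have := norm_teich_sub_lt_one hw.le
  rw [h, zero_sub, norm_neg, hw] at this
  exact lt_irrefl _ this

theorem norm_angle_sub_one_lt_one {x : ℚ_[p]} (hx : x ≠ 0) : ‖angle p x - 1‖ < 1 := by
  have hw := norm_unitPart hx
  have hT := norm_teich_sub_lt_one hw.le
  have hT0 := teich_ne_zero hw
  have hT1 : ‖teich p (unitPart p x)‖ = 1 := by
    rw [← hw]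
    exact Padic.norm_eq_of_norm_sub_lt_right (by rwa [hw])
  rw [angle, div_sub_one hT0, norm_div, hT1, div_one, norm_sub_rev]
  exact hT

theorem angle_mul_one_add {x u : ℚ_[p]} (hx : x ≠ 0) (hu : ‖u‖ < 1) :
    angle p (x * (1 + u)) = angle p x * (1 + u) := by
  have hw := norm_unitPart hx
  have h1 : unitPart p (x * (1 + u)) = unitPart p x * (1 + u) := by
    rw [unitPart, unitPart, valuation_mul_one_add hx hu]
    ring
  have h2 : teich p (unitPart p x * (1 + u)) = teich p (unitPart p x) := by
    refine teich_eq_of_norm_sub_lt_one ?_ hw.le ?_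
    · rw [norm_mul, hw, norm_one_add_eq_one hu, one_mul]
    · rwa [mul_one_add, add_sub_cancel_left, norm_mul, hw, one_mul]
  rw [angle, angle, h1, h2]
  ring

theorem padicLog_mul_one_add {x u : ℚ_[p]} (hx : x ≠ 0) (hu : ‖u‖ < 1) :
    padicLog p (x * (1 + u)) = padicLog p x + logSeries p u := by
  rw [padicLog_eq_logSeries, padicLog_eq_logSeries, angle_mul_one_add hx hu,
    ← logSeries_add_add_mul (norm_angle_sub_one_lt_one hx) hu]
  congr 1
  ring

/-- The expansion `(1 + u) log (1 + u) = u + Σ_n (-1)^n u^(n+2) / ((n+1)(n+2))`. -/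
theorem hasSum_one_add_mul_logSeries {u : ℚ_[p]} (hu : ‖u‖ < 1) :
    HasSum (fun n : ℕ => (-1 : ℚ_[p]) ^ n / (((n : ℚ_[p]) + 1) * ((n : ℚ_[p]) + 2)) * u ^ (n + 2))
      ((1 + u) * logSeries p u - u) := by
  have h0 := (summable_logSeries hu).hasSum
  have h1 := (hasSum_nat_add_iff' 1).2 h0
  have h2 := (h0.mul_left u).add h1
  have hsum : (1 + u) * logSeries p u - u = u * logSeries p u +
      (logSeries p u - ∑ i ∈ Finset.range 1, (-1 : ℚ_[p]) ^ i * u ^ (i + 1) / ((i : ℚ_[p]) + 1)) := by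
    simp
    ring
  rw [hsum]
  refine Eq.subst (motive := fun F => HasSum F _) (funext fun n => ?_) h2
  have hn1 : ((n : ℚ_[p]) + 1) ≠ 0 := by exact_mod_cast n.succ_ne_zero
  have hn2 : ((n : ℚ_[p]) + 2) ≠ 0 := by exact_mod_cast (n + 1).succ_ne_zero
  have hn3 : ((n : ℚ_[p]) + 1 + 1) ≠ 0 := by exact_mod_cast (n + 1).succ_ne_zero
  push_cast
  field_simp
  ring

end Logarithm

section Stirling

variable {p : ℕ} [Fact p.Prime]

theorem norm_stirlingCoeff_mul_le {lam e : ℚ_[p]} (he : ‖e‖ ≤ 1) (n : ℕ) :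
    ‖(-1 : ℚ_[p]) ^ n / (((n : ℚ_[p]) + 1) * ((n : ℚ_[p]) + 2)) * e / lam ^ (n + 1)‖ ≤
      ((n : ℝ) + 1) * ((n : ℝ) + 2) * ‖lam⁻¹‖ ^ (n + 1) := by
  have h1 := norm_inv_natCast_add_one_le (p := p) n
  have h2 : ‖((n : ℚ_[p]) + 2)⁻¹‖ ≤ (n : ℝ) + 2 := by
    exact_mod_cast norm_inv_natCast_le (p := p) (n + 2)
  have e1 : ‖(-1 : ℚ_[p]) ^ n / (((n : ℚ_[p]) + 1) * ((n : ℚ_[p]) + 2)) * e / lam ^ (n + 1)‖ =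
      ‖((n : ℚ_[p]) + 1)⁻¹‖ * ‖((n : ℚ_[p]) + 2)⁻¹‖ * ‖e‖ * ‖lam⁻¹‖ ^ (n + 1) := by
    simp only [div_eq_mul_inv, mul_inv, norm_mul, norm_pow, norm_neg, norm_one, one_pow, one_mul,
      norm_inv, inv_pow]
  rw [e1]
  refine mul_le_mul_of_nonneg_right ?_ (by positivity)
  calc _ ≤ ‖((n : ℚ_[p]) + 1)⁻¹‖ * ‖((n : ℚ_[p]) + 2)⁻¹‖ * 1 := by gcongr
    _ ≤ _ := by rw [mul_one]; gcongr

theorem summable_stirlingBound {r : ℝ} (h0 : 0 ≤ r) (h1 : r < 1) :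
    Summable fun n : ℕ => ((n : ℝ) + 1) * ((n : ℝ) + 2) * r ^ (n + 1) := by
  have hr : ‖r‖ < 1 := by rwa [Real.norm_of_nonneg h0]
  have h := (summable_nat_add_iff 1).2 ((summable_pow_mul_geometric_of_norm_lt_one 2 hr).add
    (summable_pow_mul_geometric_of_norm_lt_one 1 hr))
  refine h.congr fun n => ?_
  push_cast
  ring

theorem hasSum_add_mul_padicLog {lam e : ℚ_[p]} (hlam : 1 < ‖lam‖) (he : ‖e‖ ≤ 1) :
    HasSum (fun n : ℕ => (-1 : ℚ_[p]) ^ n / (((n : ℚ_[p]) + 1) * ((n : ℚ_[p]) + 2)) *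
        e ^ (n + 2) / lam ^ (n + 1))
      ((lam + e) * padicLog p (lam + e) - e - (lam + e) * padicLog p lam) := by
  have hl0 : lam ≠ 0 := norm_pos_iff.1 (one_pos.trans hlam)
  have hu : ‖e / lam‖ < 1 := by
    rw [norm_div, div_lt_one (one_pos.trans hlam)]
    exact he.trans_lt hlam
  have hx : lam + e = lam * (1 + e / lam) := by field_simp
  have h := (hasSum_one_add_mul_logSeries hu).mul_left lam
  have hL := padicLog_mul_one_add hl0 hu
  rw [← hx] at hL
  have hsum : (lam + e) * padicLog p (lam + e) - e - (lam + e) * padicLog p lam =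
      lam * ((1 + e / lam) * logSeries p (e / lam) - e / lam) := by
    rw [hL]
    field_simp
    ring
  rw [hsum]
  refine Eq.subst (motive := fun F => HasSum F _) (funext fun n => ?_) h
  rw [div_pow]
  field_simp
  ring

theorem fermSum_add (g h : ℤ_[p] → ℚ_[p]) (N : ℕ) :
    fermSum p (fun a => g a + h a) N = fermSum p g N + fermSum p h N := by
  simp only [fermSum, mul_add, Finset.sum_add_distrib]

theorem fermSum_mul_const (g : ℤ_[p] → ℚ_[p]) (c : ℚ_[p]) (N : ℕ) :
    fermSum p (fun a => g a * c) N = fermSum p g N * c := by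
  simp only [fermSum, Finset.sum_mul, mul_assoc]

theorem hasSum_fermSum {G : ℕ → ℤ_[p] → ℚ_[p]} {g : ℤ_[p] → ℚ_[p]}
    (h : ∀ a, HasSum (fun n => G n a) (g a)) (N : ℕ) :
    HasSum (fun n => fermSum p (G n) N) (fermSum p g N) :=
  hasSum_sum fun a _ => (h a).mul_left _

end Stirling

end PZeta

/-- Stirling's series for `log Γ_{p,E}^f`: all fermionic integrals
`L = ∫ (λ+f(a)) log_p(λ+f(a)) dμ₋₁`, `E_m^f(0) = ∫ f(a)^m dμ₋₁`, `E_1^f(λ) = ∫ (λ+f(a)) dμ₋₁`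
exist, the series `Σ_{n≥1} ((-1)^{n+1}/(n(n+1))) E_{n+1}^f(0) λ^{-n}` (reindexed below with
`n ↦ n+1`) converges, and
`-L = -E_1^f(0) - Σ_{n≥1} ((-1)^{n+1}/(n(n+1))) E_{n+1}^f(0) λ^{-n} - E_1^f(λ)·log_p λ`. -/
theorem logGammaE_stirling (p : ℕ) [Fact p.Prime] (hp : Odd p)
    (f : ℤ_[p] → ℤ_[p]) (hf : Continuous f) (lam : ℚ_[p]) (hlam : 1 < ‖lam‖) :
    ∃ (L E1lam : ℚ_[p]) (E : ℕ → ℚ_[p]),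
      Filter.Tendsto
        (fermSum p fun a =>
          (lam + (f a : ℚ_[p])) * padicLog p (lam + (f a : ℚ_[p])))
        Filter.atTop (nhds L) ∧
      (∀ m : ℕ, Filter.Tendsto (fermSum p fun a => ((f a : ℚ_[p])) ^ m)
        Filter.atTop (nhds (E m))) ∧
      Filter.Tendsto (fermSum p fun a => lam + (f a : ℚ_[p]))
        Filter.atTop (nhds E1lam) ∧
      Summable (fun n : ℕ =>
        (-1 : ℚ_[p]) ^ n / (((n : ℚ_[p]) + 1) * ((n : ℚ_[p]) + 2)) * E (n + 2) /
          lam ^ (n + 1)) ∧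
      -L = -(E 1)
            - (∑' n : ℕ,
                (-1 : ℚ_[p]) ^ n / (((n : ℚ_[p]) + 1) * ((n : ℚ_[p]) + 2)) * E (n + 2) /
                  lam ^ (n + 1))
            - E1lam * padicLog p lam := by
  have hfc : Continuous fun a => (f a : ℚ_[p]) := continuous_subtype_val.comp hf
  have hf1 (a : ℤ_[p]) : ‖(f a : ℚ_[p])‖ ≤ 1 := PadicInt.norm_le_one (f a)
  have hex (m : ℕ) : ∃ I, Tendsto (fermSum p fun a => (f a : ℚ_[p]) ^ m) atTop (𝓝 I) :=
    exists_tendsto_fermSum hp (hfc.pow m)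
  choose E hE using hex
  obtain ⟨E1lam, hE1⟩ : ∃ I, Tendsto (fermSum p fun a => lam + (f a : ℚ_[p])) atTop (𝓝 I) :=
    exists_tendsto_fermSum hp (continuous_const.add hfc)
  have hfm (m N : ℕ) : ‖fermSum p (fun a => (f a : ℚ_[p]) ^ m) N‖ ≤ 1 :=
    norm_fermSum_le zero_le_one
      (fun a => by rw [norm_pow]; exact pow_le_one₀ (norm_nonneg _) (hf1 a)) N
  have hEm (m : ℕ) : ‖E m‖ ≤ 1 := le_of_tendsto' (hE m).norm (hfm m)
  have hbound := summable_stirlingBound (norm_nonneg lam⁻¹)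
    (by rw [norm_inv]; exact inv_lt_one_of_one_lt₀ hlam)
  refine ⟨_, E1lam, E, ?_, hE, hE1,
    hbound.of_norm_bounded fun n => norm_stirlingCoeff_mul_le (hEm _) n,
    (neg_eq_iff_eq_neg.2 rfl)⟩
  have hS (N : ℕ) := hasSum_fermSum (fun a => hasSum_add_mul_padicLog hlam (hf1 a)) N
  have hterm (N n : ℕ) : fermSum p (fun a => (-1 : ℚ_[p]) ^ n /
        (((n : ℚ_[p]) + 1) * ((n : ℚ_[p]) + 2)) * (f a : ℚ_[p]) ^ (n + 2) / lam ^ (n + 1)) N =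
      (-1 : ℚ_[p]) ^ n / (((n : ℚ_[p]) + 1) * ((n : ℚ_[p]) + 2)) *
        fermSum p (fun a => (f a : ℚ_[p]) ^ (n + 2)) N / lam ^ (n + 1) := by
    simp only [fermSum, Finset.mul_sum, Finset.sum_div]
    exact Finset.sum_congr rfl fun a _ => by ring
  simp_rw [hterm] at hS
  have hlim := (tendsto_tsum_of_dominated_convergence hbound
    (fun n => ((hE (n + 2)).const_mul ((-1 : ℚ_[p]) ^ n /
      (((n : ℚ_[p]) + 1) * ((n : ℚ_[p]) + 2)))).div_const (lam ^ (n + 1)))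
    (Eventually.of_forall fun N n => norm_stirlingCoeff_mul_le (hfm (n + 2) N) n)).congr
      fun N => (hS N).tsum_eq
  have h := (hlim.add (hE 1)).add (hE1.mul_const (padicLog p lam))
  convert h using 1
  · funext N
    rw [← fermSum_mul_const, ← fermSum_add, ← fermSum_add]
    congr 1
    funext a
    ring
  · congr 1
    ring
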